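/- arXiv:math/0504456 — 2 statements merged into one kernel-verified Lean document; each statement's English description precedes it below -/
import Mathlib

section
/- Fix t > 0 and z ∈ ℂ with z ≠ 0. Define ψ_k(z) = t^{k/2} q^{k(k+1)/4} φ_z(t q^k) and Ψ_k(z) = t^{k/2} q^{k(k+1)/4} z^k ₁φ₁(1/z; 0; q, -q^{1-k}/(tz)) for k ∈ ℤ. Then the Wronskian [ψ(z),Ψ(z)]_k = a_k·(ψ_{k+1}(z)·Ψ_k(z) - ψ_k(z)·Ψ_{k+1}(z)), where a_k = (t q^{k+1})^{-1/2}, is independent of k ∈ ℤ and equals -z·(-tzq;q)_∞·(-1/(tz);q)_∞·(1/z;q)_∞. -/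
open Finset

/-- The q-Pochhammer symbol `(a;q)_n = ∏_{j=0}^{n-1} (1 - a q^j)`. -/
noncomputable def qPoch (q a : ℂ) (n : ℕ) : ℂ :=
  ∏ j ∈ Finset.range n, (1 - a * q ^ j)

/-- The infinite q-Pochhammer symbol `(a;q)_∞ = ∏_{j=0}^∞ (1 - a q^j)`. -/
noncomputable def qPochInf (q a : ℂ) : ℂ :=
  ∏' j : ℕ, (1 - a * q ^ j)

/-- The basic hypergeometric series `₁φ₁(a; 0; q, y)`. -/
noncomputable def onePhiOne (q a y : ℂ) : ℂ :=
  ∑' n : ℕ, (qPoch q a n / qPoch q q n) * (-1) ^ n * q ^ (n * (n - 1) / 2) * y ^ n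

/-- `φ_z(x) = Σ_{n=0}^∞ (∏_{j=0}^{n-1} (z - q^j)) q^{n(n+1)/2} x^n/(q;q)_n`. -/
noncomputable def phiSW (q z x : ℂ) : ℂ :=
  ∑' n : ℕ, (∏ j ∈ Finset.range n, (z - q ^ j)) * q ^ (n * (n + 1) / 2) * x ^ n / qPoch q q n

/-- `ψ_k(z) = t^{k/2} q^{k(k+1)/4} φ_z(t q^k)`. -/
noncomputable def psiSW (q t : ℝ) (z : ℂ) (k : ℤ) : ℂ :=
  ((t ^ ((k : ℝ) / 2) * q ^ (((k * (k + 1) : ℤ) : ℝ) / 4) : ℝ) : ℂ) *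
    phiSW q z ((t : ℂ) * (q : ℂ) ^ k)

/-- `Ψ_k(z) = t^{k/2} q^{k(k+1)/4} z^k ₁φ₁(1/z; 0; q, -q^{1-k}/(tz))`. -/
noncomputable def PsiSW (q t : ℝ) (z : ℂ) (k : ℤ) : ℂ :=
  ((t ^ ((k : ℝ) / 2) * q ^ (((k * (k + 1) : ℤ) : ℝ) / 4) : ℝ) : ℂ) * z ^ k *
    onePhiOne q (1 / z) (-(q : ℂ) ^ (1 - k) / ((t : ℂ) * z))

open Filter Topology

/-- The entire function `₁φ₁(a; 0; q, -w) = ∑ (a;q)_n / (q;q)_n q^{n(n-1)/2} w^n`. -/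
noncomputable def qExp (q a w : ℂ) : ℂ :=
  ∑' n : ℕ, qPoch q a n / qPoch q q n * q ^ (n * (n - 1) / 2) * w ^ n

theorem onePhiOne_eq_qExp (q a y : ℂ) : onePhiOne q a y = qExp q a (-y) := by
  unfold onePhiOne qExp
  refine tsum_congr fun n => ?_
  rw [neg_pow y]
  ring

theorem phiSW_eq_qExp (q : ℂ) {z : ℂ} (hz : z ≠ 0) (x : ℂ) :
    phiSW q z x = qExp q (1 / z) (z * q * x) := by
  unfold phiSW qExp
  refine tsum_congr fun n => ?_
  have h1 : ∏ j ∈ Finset.range n, (z - q ^ j) = z ^ n * qPoch q (1 / z) n := by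
    unfold qPoch
    rw [← Finset.card_range n, ← Finset.prod_const, Finset.card_range, ← Finset.prod_mul_distrib]
    refine Finset.prod_congr rfl fun j _ => ?_
    field_simp
  have h2 : n * (n + 1) / 2 = n * (n - 1) / 2 + n := by
    rw [← Nat.triangle_succ, Nat.add_sub_cancel, mul_comm]
  rw [h1, h2, pow_add, mul_pow, mul_pow]
  ring

section Pochhammer

variable {q : ℂ}

theorem summable_norm_neg_mul_pow (hq : ‖q‖ < 1) (a : ℂ) :
    Summable fun j : ℕ => ‖-(a * q ^ j)‖ := by
  simp only [norm_neg, norm_mul, norm_pow]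
  exact (summable_geometric_of_lt_one (norm_nonneg q) hq).mul_left _

theorem tendsto_qPoch (hq : ‖q‖ < 1) (a : ℂ) :
    Tendsto (qPoch q a) atTop (𝓝 (qPochInf q a)) := by
  have h := (multipliable_one_add_of_summable
    (summable_norm_neg_mul_pow hq a)).tendsto_prod_tprod_nat
  simp only [← sub_eq_add_neg] at h
  exact h

theorem one_sub_self_mul_pow_ne_zero (hq : ‖q‖ < 1) (j : ℕ) : 1 - q * q ^ j ≠ 0 := by
  intro h
  have h1 : ‖q ^ (j + 1)‖ = 1 := by
    rw [pow_succ', ← sub_eq_zero.mp h, norm_one]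
  rw [norm_pow] at h1
  exact (pow_lt_one₀ (norm_nonneg q) hq j.succ_ne_zero).ne h1

theorem qPoch_self_ne_zero (hq : ‖q‖ < 1) (n : ℕ) : qPoch q q n ≠ 0 :=
  Finset.prod_ne_zero_iff.mpr fun j _ => one_sub_self_mul_pow_ne_zero hq j

theorem qPochInf_self_ne_zero (hq : ‖q‖ < 1) : qPochInf q q ≠ 0 := by
  have h := tprod_one_add_ne_zero_of_summable (f := fun j : ℕ => -(q * q ^ j))
    (fun j => by simpa only [← sub_eq_add_neg] using one_sub_self_mul_pow_ne_zero hq j)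
    (summable_norm_neg_mul_pow hq q)
  simp only [← sub_eq_add_neg] at h
  exact h

theorem tendsto_qPoch_div_qPoch (hq : ‖q‖ < 1) (a : ℂ) :
    Tendsto (fun n => qPoch q a n / qPoch q q n) atTop
      (𝓝 (qPochInf q a / qPochInf q q)) :=
  (tendsto_qPoch hq a).div (tendsto_qPoch hq q) (qPochInf_self_ne_zero hq)

theorem exists_norm_qPoch_div_qPoch_le (hq : ‖q‖ < 1) (a : ℂ) :
    ∃ C, ∀ n, ‖qPoch q a n / qPoch q q n‖ ≤ C := by
  obtain ⟨C, hC⟩ := (tendsto_qPoch_div_qPoch hq a).norm.bddAbove_range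
  exact ⟨C, fun n => hC ⟨n, rfl⟩⟩

end Pochhammer

section Series

variable {q : ℂ}

theorem summable_norm_pow_triangle_mul_pow (hq0 : q ≠ 0) (hq : ‖q‖ < 1) (w : ℂ) :
    Summable fun n : ℕ => ‖q ^ (n * (n - 1) / 2) * w ^ n‖ := by
  rcases eq_or_ne w 0 with rfl | hw
  · refine summable_of_ne_finset_zero (s := {0}) fun n hn => ?_
    simp [show n ≠ 0 by simpa using hn]
  refine (summable_of_ratio_test_tendsto_lt_one zero_lt_one
    (Eventually.of_forall fun n => ?_) ?_ :
      Summable fun n : ℕ => q ^ (n * (n - 1) / 2) * w ^ n).norm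
  · exact mul_ne_zero (pow_ne_zero _ hq0) (pow_ne_zero _ hw)
  · have h : Tendsto (fun n : ℕ => ‖q‖ ^ n * ‖w‖) atTop (𝓝 (0 * ‖w‖)) :=
      (tendsto_pow_atTop_nhds_zero_of_lt_one (norm_nonneg q) hq).mul_const _
    rw [zero_mul] at h
    refine h.congr fun n => ?_
    rw [← norm_div, Nat.triangle_succ, pow_add, pow_succ, ← norm_pow, ← norm_mul]
    congr 1
    have := pow_ne_zero (n * (n - 1) / 2) hq0
    have := pow_ne_zero n hw
    field_simp

theorem summable_qExp (hq0 : q ≠ 0) (hq : ‖q‖ < 1) (a w : ℂ) :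
    Summable fun n : ℕ => qPoch q a n / qPoch q q n * q ^ (n * (n - 1) / 2) * w ^ n := by
  obtain ⟨C, hC⟩ := exists_norm_qPoch_div_qPoch_le hq a
  refine Summable.of_norm_bounded
    ((summable_norm_pow_triangle_mul_pow hq0 hq w).mul_left C) fun n => ?_
  rw [mul_assoc, norm_mul]
  exact mul_le_mul_of_nonneg_right (hC n) (norm_nonneg _)

theorem qExp_zero_right (q a : ℂ) : qExp q a 0 = 1 := by
  unfold qExp
  rw [tsum_eq_single 0 fun n hn => by simp [hn]]
  simp [qPoch]

theorem tendsto_qExp_nhds_zero (hq0 : q ≠ 0) (hq : ‖q‖ < 1) (a : ℂ) :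
    Tendsto (qExp q a) (𝓝 0) (𝓝 1) := by
  obtain ⟨C, hC⟩ := exists_norm_qPoch_div_qPoch_le hq a
  rw [← qExp_zero_right q a]
  refine tendsto_tsum_of_dominated_convergence
    ((summable_norm_pow_triangle_mul_pow hq0 hq 1).mul_left C) (fun n => ?_) ?_
  · exact Continuous.tendsto (by fun_prop) 0
  · filter_upwards [Metric.closedBall_mem_nhds (0 : ℂ) zero_lt_one] with w hw n
    have hw1 : ‖w‖ ≤ 1 := by simpa using hw
    rw [mul_assoc, norm_mul]
    refine mul_le_mul (hC n) ?_ (norm_nonneg _) ((norm_nonneg _).trans (hC n))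
    rw [one_pow, mul_one, norm_mul, norm_pow w]
    exact mul_le_of_le_one_right (norm_nonneg _) (pow_le_one₀ (norm_nonneg _) hw1)

theorem qExp_eq (hq0 : q ≠ 0) (hq : ‖q‖ < 1) (a w : ℂ) :
    qExp q a w = (1 + w) * qExp q a (q * w) - a * w * qExp q a (q ^ 2 * w) := by
  have s := summable_qExp hq0 hq a
  have key : qExp q a w - qExp q a (q * w) =
      w * (qExp q a (q * w) - a * qExp q a (q ^ 2 * w)) := by
    unfold qExp
    rw [← (s w).tsum_sub (s (q * w)), ((s w).sub (s (q * w))).tsum_eq_zero_add,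
      ← tsum_mul_left, ← (s (q * w)).tsum_sub ((s (q ^ 2 * w)).mul_left a), ← tsum_mul_left]
    simp only [pow_zero, sub_self, zero_add]
    refine tsum_congr fun n => ?_
    have h1 : qPoch q a (n + 1) = qPoch q a n * (1 - a * q ^ n) := Finset.prod_range_succ _ _
    have h2 : qPoch q q (n + 1) = qPoch q q n * (1 - q * q ^ n) := Finset.prod_range_succ _ _
    have h3 := qPoch_self_ne_zero hq n
    have h4 := one_sub_self_mul_pow_ne_zero hq n
    rw [h1, h2, Nat.triangle_succ, pow_add, mul_pow q, mul_pow q, mul_pow (q ^ 2), pow_right_comm,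
      pow_succ w, pow_succ' q]
    generalize q ^ n = p at h4 ⊢
    rw [mul_comm] at h4
    field_simp
  linear_combination key

theorem qExp_zero_left (hq0 : q ≠ 0) (hq : ‖q‖ < 1) (w : ℂ) :
    qExp q 0 w = qPochInf q (-w) := by
  have h (n : ℕ) : qExp q 0 w = qPoch q (-w) n * qExp q 0 (q ^ n * w) := by
    induction n with
    | zero => simp [qPoch]
    | succ n ih =>
      have h1 : qPoch q (-w) (n + 1) = qPoch q (-w) n * (1 - -w * q ^ n) :=
        Finset.prod_range_succ _ _
      rw [ih, qExp_eq hq0 hq 0 (q ^ n * w), h1, pow_succ']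
      ring_nf
  have h0 : Tendsto (fun n : ℕ => q ^ n * w) atTop (𝓝 0) := by
    simpa using (tendsto_pow_atTop_nhds_zero_of_norm_lt_one hq).mul_const w
  have := (tendsto_qPoch hq (-w)).mul ((tendsto_qExp_nhds_zero hq0 hq 0).comp h0)
  rw [mul_one] at this
  exact tendsto_nhds_unique (tendsto_const_nhds.congr h) this

end Series

section Asymptotics

variable {q : ℂ}

theorem Int.two_mul_triangle (j : ℤ) : 2 * (j * (j - 1) / 2) = j * (j - 1) :=
  Int.mul_ediv_cancel' (Int.even_mul_pred_self j).two_dvd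

theorem Nat.cast_triangle (n : ℕ) : ((n * (n - 1) / 2 : ℕ) : ℤ) = (n : ℤ) * (n - 1) / 2 := by
  cases n <;> simp

theorem summable_norm_zpow_triangle_mul_zpow (hq0 : q ≠ 0) (hq : ‖q‖ < 1) (y : ℂ) :
    Summable fun j : ℤ => ‖q ^ (j * (j - 1) / 2) * y ^ j‖ := by
  refine Summable.of_nat_of_neg ?_ ?_
  · refine (summable_norm_pow_triangle_mul_pow hq0 hq y).congr fun n => ?_
    rw [← Nat.cast_triangle, zpow_natCast, zpow_natCast]
  · refine (summable_norm_pow_triangle_mul_pow hq0 hq (q / y)).congr fun n => ?_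
    have h : (-(n : ℤ)) * (-n - 1) / 2 = ((n * (n - 1) / 2 : ℕ) : ℤ) + n := by
      have h1 := Int.two_mul_triangle (-n)
      have h2 := Int.two_mul_triangle n
      rw [Nat.cast_triangle]
      linarith
    rw [h, zpow_add₀ hq0, zpow_natCast, zpow_natCast, zpow_neg, zpow_natCast, div_pow]
    congr 1
    ring

/-- The coefficients of `qExp`, extended by zero to negative indices. -/
noncomputable def qExpCoeff (q a : ℂ) (j : ℤ) : ℂ :=
  if 0 ≤ j then qPoch q a j.toNat / qPoch q q j.toNat else 0

theorem qExp_mul_zpow_neg (hq0 : q ≠ 0) (a : ℂ) {y : ℂ} (hy : y ≠ 0) (m : ℕ) :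
    (y ^ m)⁻¹ * q ^ (m * (m + 1) / 2) * qExp q a (y * (q ^ m)⁻¹) =
      ∑' j : ℤ, qExpCoeff q a (j + m) * (q ^ (j * (j - 1) / 2) * y ^ j) := by
  set f : ℤ → ℂ := fun j => qExpCoeff q a j * (q ^ (j * (j - 1) / 2) * (y * (q ^ m)⁻¹) ^ j) with hf
  have h1 : qExp q a (y * (q ^ m)⁻¹) = ∑' j, f j := by
    rw [← (Nat.cast_injective (R := ℤ)).tsum_eq]
    · refine tsum_congr fun n => ?_
      simp only [hf, qExpCoeff]
      rw [if_pos (Int.natCast_nonneg n), Int.toNat_natCast, ← Nat.cast_triangle, zpow_natCast,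
        zpow_natCast, mul_assoc]
    · intro j hj
      by_cases h : 0 ≤ j
      · exact ⟨j.toNat, Int.toNat_of_nonneg h⟩
      · simp [hf, qExpCoeff, h] at hj
  rw [h1, ← (Equiv.addRight (m : ℤ)).tsum_eq, ← tsum_mul_left]
  refine tsum_congr fun j => ?_
  simp only [hf, Equiv.coe_addRight]
  have h2 : (j + m) * (j + m - 1) / 2 =
      j * (j - 1) / 2 - ((m * (m + 1) / 2 : ℕ) : ℤ) + m * (j + m) := by
    have e1 := Int.two_mul_triangle (j + m)
    have e2 := Int.two_mul_triangle j
    have e3 := Int.two_mul_triangle ((m + 1 : ℕ) : ℤ)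
    rw [← Nat.cast_triangle, Nat.add_sub_cancel, mul_comm (m + 1)] at e3
    push_cast at e3 ⊢
    linarith
  have h3 : (y * (q ^ m)⁻¹) ^ (j + m) = y ^ j * y ^ m * (q ^ (m * (j + m)))⁻¹ := by
    rw [mul_zpow, zpow_add₀ hy, zpow_natCast, inv_zpow, zpow_mul, zpow_natCast]
  have h4 := zpow_ne_zero (m * (j + m)) hq0
  have h5 := pow_ne_zero (m * (m + 1) / 2) hq0
  have h6 := pow_ne_zero m hy
  rw [h2, h3, zpow_add₀ hq0, zpow_sub₀ hq0, zpow_natCast]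
  field_simp

theorem tendsto_qExp_mul_zpow_neg_tsum (hq0 : q ≠ 0) (hq : ‖q‖ < 1) (a : ℂ) {y : ℂ} (hy : y ≠ 0) :
    Tendsto (fun m : ℕ => (y ^ m)⁻¹ * q ^ (m * (m + 1) / 2) * qExp q a (y * (q ^ m)⁻¹)) atTop
      (𝓝 (qPochInf q a / qPochInf q q * ∑' j : ℤ, q ^ (j * (j - 1) / 2) * y ^ j)) := by
  obtain ⟨C, hC⟩ := exists_norm_qPoch_div_qPoch_le hq a
  have hC0 : 0 ≤ C := (norm_nonneg _).trans (hC 0)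
  simp only [qExp_mul_zpow_neg hq0 a hy, ← tsum_mul_left]
  refine tendsto_tsum_of_dominated_convergence
    ((summable_norm_zpow_triangle_mul_zpow hq0 hq y).mul_left C) (fun j => ?_)
    (Eventually.of_forall fun m j => ?_)
  · refine Tendsto.mul_const _ ?_
    have h : Tendsto (fun m : ℕ => (j + m).toNat) atTop atTop := by
      refine tendsto_atTop.mpr fun b => ?_
      filter_upwards [eventually_ge_atTop (b + j.natAbs)] with m hm
      omega
    refine ((tendsto_qPoch_div_qPoch hq a).comp h).congr' ?_
    filter_upwards [eventually_ge_atTop j.natAbs] with m hm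
    rw [qExpCoeff, if_pos (by omega)]
    rfl
  · rw [norm_mul]
    refine mul_le_mul_of_nonneg_right ?_ (norm_nonneg _)
    unfold qExpCoeff
    split_ifs
    · exact hC _
    · simpa using hC0

theorem qExp_zero_left_mul_zpow_neg (hq0 : q ≠ 0) (hq : ‖q‖ < 1) {y : ℂ} (hy : y ≠ 0) (m : ℕ) :
    (y ^ m)⁻¹ * q ^ (m * (m + 1) / 2) * qExp q 0 (y * (q ^ m)⁻¹) =
      qPoch q (-q / y) m * qPochInf q (-y) := by
  induction m with
  | zero => simp [qPoch, qExp_zero_left hq0 hq]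
  | succ m ih =>
    have h1 : qPoch q (-q / y) (m + 1) = qPoch q (-q / y) m * (1 - -q / y * q ^ m) :=
      Finset.prod_range_succ _ _
    have h2 : (m + 1) * (m + 1 + 1) / 2 = m * (m + 1) / 2 + (m + 1) := by
      have := Nat.triangle_succ (m + 1)
      simp only [Nat.add_sub_cancel] at this
      rw [mul_comm, this, mul_comm (m + 1)]
    have h3 : q * (y * (q ^ (m + 1))⁻¹) = y * (q ^ m)⁻¹ := by
      rw [pow_succ]
      field_simp
    rw [h1, qExp_eq hq0 hq, h3, h2, mul_right_comm (qPoch q _ m), ← ih, pow_add q, pow_succ y,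
      pow_succ q]
    have := pow_ne_zero m hq0
    field_simp
    ring

/-- The Jacobi triple product identity. -/
theorem tsum_zpow_triangle_mul_zpow (hq0 : q ≠ 0) (hq : ‖q‖ < 1) {y : ℂ} (hy : y ≠ 0) :
    ∑' j : ℤ, q ^ (j * (j - 1) / 2) * y ^ j =
      qPochInf q q * qPochInf q (-y) * qPochInf q (-q / y) := by
  have h1 := tendsto_qExp_mul_zpow_neg_tsum hq0 hq 0 hy
  simp only [qExp_zero_left_mul_zpow_neg hq0 hq hy] at h1
  have h2 := tendsto_nhds_unique h1 ((tendsto_qPoch hq (-q / y)).mul_const _)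
  have h3 : qPochInf q 0 = 1 := by simp [qPochInf]
  have h4 := qPochInf_self_ne_zero hq
  rw [h3, one_div, inv_mul_eq_iff_eq_mul₀ h4] at h2
  rw [h2]
  ring

theorem tendsto_qExp_mul_zpow_neg (hq0 : q ≠ 0) (hq : ‖q‖ < 1) (a : ℂ) {y : ℂ} (hy : y ≠ 0) :
    Tendsto (fun m : ℕ => (y ^ m)⁻¹ * q ^ (m * (m + 1) / 2) * qExp q a (y * (q ^ m)⁻¹)) atTop
      (𝓝 (qPochInf q (-y) * qPochInf q (-q / y) * qPochInf q a)) := by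
  convert tendsto_qExp_mul_zpow_neg_tsum hq0 hq a hy using 2
  rw [tsum_zpow_triangle_mul_zpow hq0 hq hy]
  have := qPochInf_self_ne_zero hq
  field_simp

end Asymptotics

/-- The Wronskian of the solutions `k ↦ qExp q a (y q^k)` and `k ↦ a^{-k} qExp q a (a q^{2-k} / y)`
of the three term recurrence behind `qExp_eq`, in the normalization that makes it constant. -/
noncomputable def qExpWronskian (q a y : ℂ) (k : ℤ) : ℂ :=
  y ^ k * q ^ (k * (k - 1) / 2) *
    (qExp q a (y * q ^ (k + 1)) * qExp q a (q ^ (2 - k) / y) -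
      a⁻¹ * qExp q a (y * q ^ k) * qExp q a (q ^ (1 - k) / y))

section Wronskian

variable {q : ℂ}

theorem qExpWronskian_add_one (hq0 : q ≠ 0) (hq : ‖q‖ < 1) {a y : ℂ} (ha : a ≠ 0) (hy : y ≠ 0)
    (k : ℤ) : qExpWronskian q a y (k + 1) = qExpWronskian q a y k := by
  have hk := zpow_ne_zero k hq0
  have e1 := qExp_eq hq0 hq a (y * q ^ k)
  have e2 := qExp_eq hq0 hq a (q ^ (-k) / y)
  have h0 : q ^ (k + 1) = q * q ^ k := by rw [zpow_add_one₀ hq0, mul_comm]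
  have h1 : q * (y * q ^ k) = y * q ^ (k + 1) := by rw [h0]; ring
  have h2 : q ^ 2 * (y * q ^ k) = y * q ^ (k + 1 + 1) := by
    rw [zpow_add_one₀ hq0 (k + 1), h0]; ring
  have h3 : q * (q ^ (-k) / y) = q ^ (1 - k) / y := by
    rw [sub_eq_add_neg, zpow_add₀ hq0, zpow_one]; ring
  have h4 : q ^ 2 * (q ^ (-k) / y) = q ^ (2 - k) / y := by
    rw [sub_eq_add_neg, zpow_add₀ hq0]; norm_cast; ring
  rw [h1, h2] at e1
  rw [h3, h4] at e2
  have h5 : (k + 1) * (k + 1 - 1) / 2 = k * (k - 1) / 2 + k := by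
    have e1 := Int.two_mul_triangle (k + 1)
    have e2 := Int.two_mul_triangle k
    linarith
  unfold qExpWronskian
  rw [e1, h5, zpow_add₀ hq0, zpow_add_one₀ hy, show 2 - (k + 1) = 1 - k by ring,
    show 1 - (k + 1) = -k by ring, e2, zpow_neg]
  field_simp
  ring

theorem qExpWronskian_eq (hq0 : q ≠ 0) (hq : ‖q‖ < 1) {a y : ℂ} (ha : a ≠ 0) (hy : y ≠ 0)
    (k : ℤ) : qExpWronskian q a y k =
      -a⁻¹ * (qPochInf q (-y) * qPochInf q (-q / y) * qPochInf q a) := by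
  set L := qPochInf q (-y) * qPochInf q (-q / y) * qPochInf q a
  set h : ℕ → ℂ := fun m => (y ^ m)⁻¹ * q ^ (m * (m + 1) / 2) * qExp q a (y * (q ^ m)⁻¹) with hh
  have hL : Tendsto h atTop (𝓝 L) := tendsto_qExp_mul_zpow_neg hq0 hq a hy
  have hconst : ∀ p : ℕ, qExpWronskian q a y (-((p : ℤ) + 1)) = qExpWronskian q a y k := by
    have h0 (j : ℤ) : qExpWronskian q a y j = qExpWronskian q a y 0 := by
      induction j using Int.induction_on with
      | zero => rfl
      | succ n ih => rw [qExpWronskian_add_one hq0 hq ha hy, ih]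
      | pred n ih => rw [← ih, ← qExpWronskian_add_one hq0 hq ha hy, sub_add_cancel]
    intro p
    rw [h0, h0 k]
  have hform (p : ℕ) : qExpWronskian q a y (-((p : ℤ) + 1)) =
      h p * (y⁻¹ * q ^ (p + 1)) * qExp q a (q ^ (p + 3) / y) -
        a⁻¹ * h (p + 1) * qExp q a (q ^ (p + 2) / y) := by
    have e1 : -((p : ℤ) + 1) * (-((p : ℤ) + 1) - 1) / 2 = ((p + 1) * (p + 1 + 1) / 2 : ℕ) := by
      push_cast
      ring_nf
    have e2 : (p + 1) * (p + 1 + 1) / 2 = p * (p + 1) / 2 + (p + 1) := by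
      have := Nat.triangle_succ (p + 1)
      simp only [Nat.add_sub_cancel] at this
      rw [mul_comm, this, mul_comm (p + 1)]
    have e3 : q ^ (-((p : ℤ) + 1) + 1) = (q ^ p)⁻¹ := by
      rw [neg_add, neg_add_cancel_right, zpow_neg, zpow_natCast]
    have e4 : q ^ (2 - -((p : ℤ) + 1)) = q ^ (p + 3) := by
      rw [← zpow_natCast]; push_cast; ring_nf
    have e5 : q ^ (1 - -((p : ℤ) + 1)) = q ^ (p + 2) := by
      rw [← zpow_natCast]; push_cast; ring_nf
    have e6 (x : ℂ) : x ^ (-((p : ℤ) + 1)) = (x ^ (p + 1))⁻¹ := by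
      rw [zpow_neg]; norm_cast
    simp only [hh, qExpWronskian]
    rw [e1, e3, e4, e5, e6, e6, zpow_natCast, e2, pow_succ y, pow_add q (p * (p + 1) / 2), mul_inv]
    ring
  have hq' := tendsto_pow_atTop_nhds_zero_of_norm_lt_one hq
  have hG (i : ℕ) : Tendsto (fun p : ℕ => qExp q a (q ^ (p + i) / y)) atTop (𝓝 1) := by
    refine (tendsto_qExp_nhds_zero hq0 hq a).comp ?_
    simpa using ((tendsto_add_atTop_iff_nat i).mpr hq').div_const y
  have hlim := ((hL.mul (((tendsto_add_atTop_iff_nat 1).mpr hq').const_mul y⁻¹)).mul (hG 3)).sub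
    ((((tendsto_add_atTop_iff_nat 1).mpr hL).const_mul a⁻¹).mul (hG 2))
  rw [mul_zero, mul_zero, zero_mul, zero_sub, mul_one, ← neg_mul] at hlim
  exact tendsto_nhds_unique
    (tendsto_const_nhds.congr fun p => (hconst p).symm.trans (hform p)) hlim

end Wronskian

/-- The product of the weights in `psiSW` and `PsiSW` at `k` and `k + 1`, times `a_k`. -/
theorem weight_mul_weight_div_sqrt {q t : ℝ} (hq0 : 0 < q) (ht : 0 < t) (k : ℤ) :
    1 / √(t * q ^ (k + 1)) *
      ((t ^ (((k + 1 : ℤ) : ℝ) / 2) * q ^ ((((k + 1) * (k + 1 + 1) : ℤ) : ℝ) / 4)) *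
        (t ^ ((k : ℝ) / 2) * q ^ (((k * (k + 1) : ℤ) : ℝ) / 4))) =
      t ^ k * q ^ (k + k * (k - 1) / 2) := by
  have h : ((k * (k - 1) / 2 : ℤ) : ℝ) = k * (k - 1) / 2 := by
    have := congrArg (Int.cast (R := ℝ)) (Int.two_mul_triangle k)
    push_cast at this
    linarith
  rw [Real.sqrt_eq_rpow, ← Real.rpow_intCast, ← Real.rpow_intCast, ← Real.rpow_intCast,
    Real.mul_rpow ht.le (Real.rpow_nonneg hq0.le _), ← Real.rpow_mul hq0.le, one_div,
    mul_inv, ← Real.rpow_neg ht.le, ← Real.rpow_neg hq0.le]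
  calc _ = (t ^ (-(1 / 2) : ℝ) * t ^ (((k + 1 : ℤ) : ℝ) / 2) * t ^ ((k : ℝ) / 2)) *
        (q ^ (-(((k + 1 : ℤ) : ℝ) * (1 / 2))) * q ^ ((((k + 1) * (k + 1 + 1) : ℤ) : ℝ) / 4) *
          q ^ (((k * (k + 1) : ℤ) : ℝ) / 4)) := by ring
    _ = _ := by
      simp only [← Real.rpow_add ht, ← Real.rpow_add hq0]
      push_cast [h]
      congr 2 <;> ring

/-- for `0 < q < 1`, `t > 0` and `z ≠ 0`, the Wronskian
`a_k (ψ_{k+1}(z) Ψ_k(z) - ψ_k(z) Ψ_{k+1}(z))` with `a_k = (t q^{k+1})^{-1/2}` is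
independent of `k` and equals `-z (-tzq;q)_∞ (-1/(tz);q)_∞ (1/z;q)_∞`. -/
theorem wronskian_psiSW_PsiSW (q : ℝ) (hq0 : 0 < q) (hq1 : q < 1)
    (t : ℝ) (ht : 0 < t) (z : ℂ) (hz : z ≠ 0) (k : ℤ) :
    ((1 / Real.sqrt (t * q ^ (k + 1)) : ℝ) : ℂ) *
        (psiSW q t z (k + 1) * PsiSW q t z k - psiSW q t z k * PsiSW q t z (k + 1)) =
      -z * qPochInf q (-(t : ℂ) * z * q) * qPochInf q (-1 / ((t : ℂ) * z)) *
        qPochInf q (1 / z) := by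
  have hqc0 : (q : ℂ) ≠ 0 := Complex.ofReal_ne_zero.mpr hq0.ne'
  have hqc1 : ‖(q : ℂ)‖ < 1 := by rwa [Complex.norm_of_nonneg hq0.le]
  have htc : (t : ℂ) ≠ 0 := Complex.ofReal_ne_zero.mpr ht.ne'
  have hy : (t : ℂ) * z * q ≠ 0 := mul_ne_zero (mul_ne_zero htc hz) hqc0
  have hW := qExpWronskian_eq hqc0 hqc1 (one_div_ne_zero hz) hy k
  have hweight := congrArg ((↑) : ℝ → ℂ) (weight_mul_weight_div_sqrt hq0 ht k)
  have e1 (j : ℤ) : z * (q : ℂ) * (t * (q : ℂ) ^ j) = t * z * q * (q : ℂ) ^ j := by ring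
  have e2 (j : ℤ) : -(-(q : ℂ) ^ (1 - j) / (t * z)) = (q : ℂ) ^ (2 - j) / (t * z * q) := by
    rw [show 2 - j = 1 - j + 1 by ring, zpow_add_one₀ hqc0]
    field_simp
  have e3 : -(q : ℂ) / (t * z * q) = -1 / (t * z) := by field_simp
  rw [e3, ← neg_mul, ← neg_mul, one_div, inv_inv, ← one_div] at hW
  simp only [psiSW, PsiSW, phiSW_eq_qExp _ hz, onePhiOne_eq_qExp, e1, e2]
  calc _ = (((1 / √(t * q ^ (k + 1)) : ℝ) : ℂ) *
          (((t ^ (((k + 1 : ℤ) : ℝ) / 2) * q ^ ((((k + 1) * (k + 1 + 1) : ℤ) : ℝ) / 4) : ℝ) : ℂ) *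
            ((t ^ ((k : ℝ) / 2) * q ^ (((k * (k + 1) : ℤ) : ℝ) / 4) : ℝ) : ℂ))) * z ^ k *
          (qExp q (1 / z) (t * z * q * (q : ℂ) ^ (k + 1)) *
              qExp q (1 / z) ((q : ℂ) ^ (2 - k) / (t * z * q)) -
            z * qExp q (1 / z) (t * z * q * (q : ℂ) ^ k) *
              qExp q (1 / z) ((q : ℂ) ^ (2 - (k + 1)) / (t * z * q))) := by
        rw [zpow_add_one₀ hz]
        ring
    _ = qExpWronskian q (1 / z) (t * z * q) k := by
        rw [← Complex.ofReal_mul, ← Complex.ofReal_mul, hweight]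
        push_cast
        rw [qExpWronskian, zpow_add₀ hqc0, mul_zpow, mul_zpow, one_div, inv_inv,
          show 2 - (k + 1) = 1 - k by ring]
        ring
    _ = _ := by
        rw [hW]
        ring
end

section
/- Fix t > 0. For all m, n ∈ ℕ the doubly infinite sum Σ_{k∈ℤ} t^k·q^{k(k+1)/2}·S_n(t q^k;q)·S_m(t q^k;q) converges absolutely and equals δ_{m,n}·(-tq;q)_∞·(-1/t;q)_∞·(q;q)_∞/(q^n·(q;q)_n). In other words, the Stieltjes–Wigert polynomials are orthogonal with respect to the discrete measure Σ_{k∈ℤ} t^k q^{k(k+1)/2} δ_{t q^k} with the stated norms. -/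
open Finset

/-- The real q-Pochhammer symbol `(a;q)_n = ∏_{j=0}^{n-1} (1 - a q^j)`. -/
noncomputable def qPochR (q a : ℝ) (n : ℕ) : ℝ :=
  ∏ j ∈ Finset.range n, (1 - a * q ^ j)

/-- The infinite q-Pochhammer symbol `(a;q)_∞ = ∏_{j=0}^∞ (1 - a q^j)`. -/
noncomputable def qPochInfR (q a : ℝ) : ℝ :=
  ∏' j : ℕ, (1 - a * q ^ j)

/-- The Stieltjes--Wigert polynomial
`S_n(x;q) = (1/(q;q)_n) Σ_{k=0}^n ((q;q)_n/((q;q)_k (q;q)_{n-k})) (-1)^k q^{k²} x^k`. -/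
noncomputable def stieltjesWigertR (q : ℝ) (n : ℕ) (x : ℝ) : ℝ :=
  (1 / qPochR q q n) *
    ∑ k ∈ Finset.range (n + 1),
      (qPochR q q n / (qPochR q q k * qPochR q q (n - k))) * (-1) ^ k * q ^ (k ^ 2) * x ^ k

open Filter Topology

/-- The Gaussian binomial coefficient, defined by the `q`-Pascal recursion. -/
noncomputable def qBinomR (q : ℝ) : ℕ → ℕ → ℝ
  | _, 0 => 1
  | 0, _ + 1 => 0
  | n + 1, k + 1 => q ^ (k + 1) * qBinomR q n (k + 1) + qBinomR q n k

lemma qBinomR_zero_right (q : ℝ) (n : ℕ) : qBinomR q n 0 = 1 := by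
  cases n <;> rfl

lemma qBinomR_succ_succ (q : ℝ) (n k : ℕ) :
    qBinomR q (n + 1) (k + 1) = q ^ (k + 1) * qBinomR q n (k + 1) + qBinomR q n k := rfl

lemma qBinomR_eq_zero_of_lt (q : ℝ) {n k : ℕ} (h : n < k) : qBinomR q n k = 0 := by
  induction n generalizing k with
  | zero => obtain ⟨k, rfl⟩ := Nat.exists_eq_succ_of_ne_zero h.ne'; rfl
  | succ n ih =>
    obtain ⟨k, rfl⟩ := Nat.exists_eq_succ_of_ne_zero (Nat.ne_zero_of_lt h)
    rw [Nat.succ_eq_add_one, qBinomR_succ_succ, ih (by omega), ih (by omega)]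
    simp

lemma qPochR_zero (q a : ℝ) : qPochR q a 0 = 1 := by simp [qPochR]

lemma qPochR_self_succ (q : ℝ) (n : ℕ) :
    qPochR q q (n + 1) = qPochR q q n * (1 - q ^ (n + 1)) := by
  simp only [qPochR, Finset.prod_range_succ]
  ring

lemma qBinomR_add_mul (q : ℝ) (k m : ℕ) :
    qBinomR q (k + m) k * (qPochR q q k * qPochR q q m) = qPochR q q (k + m) := by
  induction h : k + m generalizing k m with
  | zero =>
    obtain ⟨rfl, rfl⟩ : k = 0 ∧ m = 0 := by omega
    simp [qBinomR_zero_right, qPochR_zero]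
  | succ n ih =>
    rcases k with _ | k
    · obtain rfl : m = n + 1 := by omega
      simp [qBinomR_zero_right, qPochR_zero]
    rw [qBinomR_succ_succ, qPochR_self_succ q n]
    have h₁ := ih k m (by omega)
    rcases m with _ | m
    · obtain rfl : k = n := by omega
      rw [qBinomR_eq_zero_of_lt q (Nat.lt_succ_self _), qPochR_self_succ]
      linear_combination (1 - q ^ (k + 1)) * h₁
    · have h₂ := ih (k + 1) m (by omega)
      obtain rfl : n = k + m + 1 := by omega
      simp only [qPochR_self_succ] at h₁ h₂ ⊢
      linear_combination (1 - q ^ (k + 1)) * h₁ + q ^ (k + 1) * (1 - q ^ (m + 1)) * h₂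

/-- The finite `q`-binomial theorem. -/
lemma sum_qBinomR_mul_pow (q z : ℝ) (n : ℕ) :
    ∑ k ∈ range (n + 1), qBinomR q n k * q ^ (k.choose 2) * z ^ k =
      ∏ j ∈ range n, (1 + z * q ^ j) := by
  induction n generalizing z with
  | zero => simp [qBinomR_zero_right]
  | succ n ih =>
    have hshift : ∑ k ∈ range (n + 1),
        qBinomR q n (k + 1) * q ^ ((k + 1).choose 2) * (z * q) ^ (k + 1) + 1 =
          ∑ k ∈ range (n + 1), qBinomR q n k * q ^ (k.choose 2) * (z * q) ^ k := by
      have h := Finset.sum_range_succ' (fun k => qBinomR q n k * q ^ (k.choose 2) * (z * q) ^ k)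
        (n + 1)
      rw [Finset.sum_range_succ, qBinomR_eq_zero_of_lt q (Nat.lt_succ_self n)] at h
      simpa [qBinomR_zero_right] using h.symm
    have hsplit : ∀ k, qBinomR q (n + 1) (k + 1) * q ^ ((k + 1).choose 2) * z ^ (k + 1) =
        qBinomR q n (k + 1) * q ^ ((k + 1).choose 2) * (z * q) ^ (k + 1) +
          z * (qBinomR q n k * q ^ (k.choose 2) * (z * q) ^ k) := by
      intro k
      rw [qBinomR_succ_succ, Nat.choose_succ_succ' k 1, Nat.choose_one_right]
      ring
    have hprod : ∏ j ∈ range n, (1 + z * q ^ (j + 1)) = ∏ j ∈ range n, (1 + z * q * q ^ j) :=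
      Finset.prod_congr rfl fun j _ => by ring
    rw [Finset.prod_range_succ', hprod, ← ih (z * q), Finset.sum_range_succ',
      Finset.sum_congr rfl fun k _ => hsplit k, Finset.sum_add_distrib, ← Finset.mul_sum]
    simp only [qBinomR_zero_right, Nat.choose_zero_succ, pow_zero, mul_one]
    linear_combination hshift

lemma qPochR_self_pos {q : ℝ} (hq0 : 0 < q) (hq1 : q < 1) (n : ℕ) : 0 < qPochR q q n := by
  refine Finset.prod_pos fun j _ => ?_
  rw [← pow_succ']
  exact sub_pos.2 (pow_lt_one₀ hq0.le hq1 (by omega))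

lemma triangle_two_mul (k : ℤ) : 2 * (k * (k + 1) / 2) = k * (k + 1) :=
  Int.two_mul_ediv_two_of_even (Int.even_mul_succ_self k)

lemma choose_two_two_mul (k : ℕ) : 2 * ((k.choose 2 : ℕ) : ℤ) = k * (k - 1) := by
  induction k with
  | zero => simp
  | succ k ih =>
    rw [Nat.choose_succ_succ' k 1, Nat.choose_one_right]
    push_cast
    linear_combination ih

/-- The weight `t^k q^{k(k+1)/2}` is summable over the integers. -/
lemma summable_theta {q : ℝ} (hq0 : 0 < q) (hq1 : q < 1) {t : ℝ} (ht : 0 < t) :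
    Summable fun k : ℤ => t ^ k * q ^ (k * (k + 1) / 2) := by
  have aux : ∀ (f : ℕ → ℝ) (c : ℝ), (∀ n, 0 < f n) → (∀ n, f (n + 1) = c * q ^ n * f n) →
      Summable f := by
    intro f c hf hrec
    refine summable_of_ratio_test_tendsto_lt_one zero_lt_one
      (Eventually.of_forall fun n => (hf n).ne') ?_
    have h : Tendsto (fun n => ‖c‖ * q ^ n) atTop (𝓝 (‖c‖ * 0)) :=
      (tendsto_pow_atTop_nhds_zero_of_lt_one hq0.le hq1).const_mul _
    rw [mul_zero] at h
    refine h.congr fun n => ?_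
    rw [hrec, norm_mul, norm_mul, norm_pow, Real.norm_of_nonneg hq0.le,
      mul_div_cancel_right₀ _ (norm_pos_iff.2 (hf n).ne').ne']
  refine Summable.of_nat_of_neg (aux _ (t * q) (fun n => by positivity) fun n => ?_)
    (aux _ t⁻¹ (fun n => by positivity) fun n => ?_)
  · have e : ((n + 1 : ℕ) : ℤ) * (((n + 1 : ℕ) : ℤ) + 1) / 2 =
        (n : ℤ) * ((n : ℤ) + 1) / 2 + (n + 1 : ℕ) := by
      have h₁ := triangle_two_mul ((n + 1 : ℕ) : ℤ)
      have h₂ := triangle_two_mul (n : ℤ)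
      push_cast at *
      linarith
    rw [e, zpow_add₀ hq0.ne', zpow_natCast, zpow_natCast, zpow_natCast]
    ring
  · have e : -((n + 1 : ℕ) : ℤ) * (-((n + 1 : ℕ) : ℤ) + 1) / 2 =
        -(n : ℤ) * (-(n : ℤ) + 1) / 2 + (n : ℕ) := by
      have h₁ := triangle_two_mul (-((n + 1 : ℕ) : ℤ))
      have h₂ := triangle_two_mul (-(n : ℤ))
      push_cast at *
      linarith
    rw [e, zpow_add₀ hq0.ne', zpow_natCast, zpow_neg, zpow_neg, zpow_natCast, zpow_natCast,
      pow_succ, mul_inv]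
    ring

lemma tendsto_prod_qPochInfR {q : ℝ} (hq0 : 0 < q) (hq1 : q < 1) (a : ℝ) :
    Tendsto (fun n => qPochR q a n) atTop (𝓝 (qPochInfR q a)) := by
  have hs : Summable fun j : ℕ => ‖-(a * q ^ j)‖ :=
    (((summable_geometric_of_lt_one hq0.le hq1).mul_left a).neg).norm
  have := (multipliable_one_add_of_summable hs).hasProd.tendsto_prod_nat
  simpa only [qPochR, qPochInfR, ← sub_eq_add_neg] using this

lemma qPochInfR_self_pos {q : ℝ} (hq0 : 0 < q) (hq1 : q < 1) : 0 < qPochInfR q q := by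
  refine lt_of_le_of_ne (ge_of_tendsto' (tendsto_prod_qPochInfR hq0 hq1 q)
    fun n => (qPochR_self_pos hq0 hq1 n).le) (Ne.symm ?_)
  have hs : Summable fun j : ℕ => ‖-(q * q ^ j)‖ :=
    (((summable_geometric_of_lt_one hq0.le hq1).mul_left q).neg).norm
  have h := tprod_one_add_ne_zero_of_summable (f := fun j : ℕ => -(q * q ^ j)) (fun j => ?_) hs
  · simpa only [qPochInfR, ← sub_eq_add_neg] using h
  · rw [← sub_eq_add_neg, ← pow_succ']
    exact (sub_pos.2 (pow_lt_one₀ hq0.le hq1 (by omega))).ne'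

lemma qPochInfR_self_le {q : ℝ} (hq0 : 0 < q) (hq1 : q < 1) (n : ℕ) :
    qPochInfR q q ≤ qPochR q q n := by
  refine (antitone_nat_of_succ_le fun n => ?_).le_of_tendsto (tendsto_prod_qPochInfR hq0 hq1 q) n
  rw [qPochR_self_succ]
  exact mul_le_of_le_one_right (qPochR_self_pos hq0 hq1 n).le
    (sub_le_self _ (pow_nonneg hq0.le _))

lemma qPochR_self_le_one {q : ℝ} (hq0 : 0 < q) (hq1 : q < 1) (n : ℕ) : qPochR q q n ≤ 1 := by
  refine Finset.prod_le_one (fun j _ => ?_) fun j _ => ?_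
  · rw [← pow_succ']
    exact (sub_pos.2 (pow_lt_one₀ hq0.le hq1 (by omega))).le
  · exact sub_le_self _ (by positivity)

lemma qBinomR_add {q : ℝ} (hq0 : 0 < q) (hq1 : q < 1) (k m : ℕ) :
    qBinomR q (k + m) k = qPochR q q (k + m) / (qPochR q q k * qPochR q q m) := by
  rw [← qBinomR_add_mul, mul_div_cancel_right₀]
  exact (mul_pos (qPochR_self_pos hq0 hq1 k) (qPochR_self_pos hq0 hq1 m)).ne'

/-- The symmetric form of the finite `q`-binomial theorem. -/
lemma sum_Icc_qBinomR {q : ℝ} (hq0 : 0 < q) {t : ℝ} (ht : 0 < t) (N : ℕ) :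
    ∑ l ∈ Finset.Icc (-(N : ℤ)) N, qBinomR q (2 * N) (l + N).toNat *
        (t ^ l * q ^ (l * (l + 1) / 2)) =
      qPochR q (-t * q) N * qPochR q (-1 / t) N := by
  have hprod : ∏ j ∈ range (2 * N), (1 + t * q ^ (1 - N : ℤ) * q ^ j) =
      t ^ N * q ^ (-((N.choose 2 : ℕ) : ℤ)) * (qPochR q (-t * q) N * qPochR q (-1 / t) N) := by
    rw [two_mul, Finset.prod_range_add, ← Finset.prod_range_reflect, mul_comm]
    have h₁ : ∏ j ∈ range N, (1 + t * q ^ (1 - N : ℤ) * q ^ (N + j)) = qPochR q (-t * q) N := by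
      refine Finset.prod_congr rfl fun j _ => ?_
      have : q ^ (1 - N : ℤ) * q ^ (N + j) = q * q ^ j := by
        rw [← zpow_natCast, ← zpow_add₀ hq0.ne', ← pow_succ', ← zpow_natCast]
        congr 1
        push_cast
        ring
      linear_combination t * this
    have h₂ : ∏ j ∈ range N, (1 + t * q ^ (1 - N : ℤ) * q ^ (N - 1 - j)) =
        ∏ j ∈ range N, (t * q ^ (-(j : ℤ)) * (1 - -1 / t * q ^ j)) := by
      refine Finset.prod_congr rfl fun j hj => ?_
      have hj' := Finset.mem_range.1 hj
      have : q ^ (1 - N : ℤ) * q ^ (N - 1 - j) = q ^ (-(j : ℤ)) := by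
        rw [← zpow_natCast, ← zpow_add₀ hq0.ne']
        congr 1
        omega
      rw [mul_assoc, this, zpow_neg, zpow_natCast]
      field_simp
      ring
    have h₃ : ∀ M : ℕ, ∏ j ∈ range M, (t * q ^ (-(j : ℤ))) =
        t ^ M * q ^ (-((M.choose 2 : ℕ) : ℤ)) := by
      intro M
      induction M with
      | zero => simp
      | succ M ih =>
        rw [Finset.prod_range_succ, ih, Nat.choose_succ_succ' M 1, Nat.choose_one_right,
          Nat.cast_add, neg_add, zpow_add₀ hq0.ne']
        ring
    rw [h₁, h₂, Finset.prod_mul_distrib, h₃]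
    simp only [qPochR]
    ring
  have hc : t ^ N * q ^ (-((N.choose 2 : ℕ) : ℤ)) ≠ 0 := by positivity
  refine mul_left_cancel₀ hc ?_
  rw [← hprod, ← sum_qBinomR_mul_pow, Finset.mul_sum]
  refine Finset.sum_nbij' (fun l => (l + N).toNat) (fun k => (k : ℤ) - N) ?_ ?_ ?_ ?_ ?_
  · intro l hl
    simp only [Finset.mem_Icc, Finset.mem_range] at *
    omega
  · intro k hk
    simp only [Finset.mem_Icc, Finset.mem_range] at *
    omega
  · intro l hl
    simp only [Finset.mem_Icc] at *
    omega
  · intro k hk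
    omega
  · intro l hl
    obtain ⟨k, hk⟩ : ∃ k : ℕ, l = k - N :=
      ⟨(l + N).toNat, by simp only [Finset.mem_Icc] at hl; omega⟩
    subst hk
    have hk : ((k : ℤ) - N + N).toNat = k := by omega
    rw [hk, mul_pow, ← zpow_natCast (q ^ (1 - N : ℤ)), ← zpow_mul, zpow_sub₀ ht.ne',
      zpow_natCast, zpow_natCast]
    have e : q ^ (-((N.choose 2 : ℕ) : ℤ)) * q ^ (((k : ℤ) - N) * ((k : ℤ) - N + 1) / 2) =
        q ^ (k.choose 2) * q ^ ((1 - N : ℤ) * k) := by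
      rw [← zpow_natCast, ← zpow_add₀ hq0.ne', ← zpow_add₀ hq0.ne']
      congr 1
      have h₁ := triangle_two_mul ((k : ℤ) - N)
      have h₂ := choose_two_two_mul k
      have h₃ := choose_two_two_mul N
      linarith
    have : t ^ N ≠ 0 := by positivity
    field_simp
    linear_combination qBinomR q (2 * N) k * e

/-- The Jacobi triple product identity. -/
lemma tsum_theta {q : ℝ} (hq0 : 0 < q) (hq1 : q < 1) {t : ℝ} (ht : 0 < t) :
    ∑' k : ℤ, t ^ k * q ^ (k * (k + 1) / 2) =
      qPochInfR q (-t * q) * qPochInfR q (-1 / t) * qPochInfR q q := by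
  have hQ := qPochInfR_self_pos hq0 hq1
  set Q := qPochInfR q q with hQdef
  have hlim := tendsto_prod_qPochInfR hq0 hq1 q
  rw [← hQdef] at hlim
  let F : ℕ → ℤ → ℝ := fun N l => if l ∈ Finset.Icc (-(N : ℤ)) N then
    qBinomR q (2 * N) (l + N).toNat * (t ^ l * q ^ (l * (l + 1) / 2)) else 0
  have hF : ∀ N, ∑' l, F N l = qPochR q (-t * q) N * qPochR q (-1 / t) N := by
    intro N
    rw [← sum_Icc_qBinomR hq0 ht, tsum_eq_sum (s := Finset.Icc (-(N : ℤ)) N)]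
    · exact Finset.sum_congr rfl fun l hl => if_pos hl
    · exact fun l hl => if_neg hl
  have hcoef : ∀ N : ℕ, ∀ l ∈ Finset.Icc (-(N : ℤ)) N, qBinomR q (2 * N) (l + N).toNat =
      qPochR q q (2 * N) / (qPochR q q (l + N).toNat * qPochR q q (N - l).toNat) := by
    intro N l hl
    simp only [Finset.mem_Icc] at hl
    have h := qBinomR_add hq0 hq1 (l + N).toNat (N - l).toNat
    rwa [show (l + N).toNat + (N - l).toNat = 2 * N by omega] at h
  have hT : Tendsto (fun N => ∑' l, F N l) atTop
      (𝓝 (∑' l : ℤ, Q⁻¹ * (t ^ l * q ^ (l * (l + 1) / 2)))) := by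
    refine tendsto_tsum_of_dominated_convergence
      (bound := fun l : ℤ => (Q * Q)⁻¹ * (t ^ l * q ^ (l * (l + 1) / 2)))
      ((summable_theta hq0 hq1 ht).mul_left _) (fun l => ?_) (Eventually.of_forall fun N l => ?_)
    · have hmem : ∀ᶠ N : ℕ in atTop, l ∈ Finset.Icc (-(N : ℤ)) N := by
        filter_upwards [eventually_ge_atTop l.natAbs] with N hN
        simp only [Finset.mem_Icc]
        omega
      have h₀ : Tendsto (fun N : ℕ => 2 * N) atTop atTop :=
        tendsto_atTop_mono (fun N => show N ≤ 2 * N by omega) tendsto_id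
      have h₁ : Tendsto (fun N : ℕ => (l + N).toNat) atTop atTop :=
        tendsto_atTop_mono (fun N => by omega) (tendsto_sub_atTop_nat l.natAbs)
      have h₂ : Tendsto (fun N : ℕ => (N - l).toNat) atTop atTop :=
        tendsto_atTop_mono (fun N => by omega) (tendsto_sub_atTop_nat l.natAbs)
      have h := (((hlim.comp h₀).div ((hlim.comp h₁).mul (hlim.comp h₂)) (by positivity)).mul_const
        (t ^ l * q ^ (l * (l + 1) / 2)))
      rw [show Q / (Q * Q) = Q⁻¹ by field_simp] at h
      refine h.congr' ?_
      filter_upwards [hmem] with N hN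
      simp only [F, if_pos hN, hcoef N l hN, Function.comp, Pi.div_apply]
    · by_cases hl : l ∈ Finset.Icc (-(N : ℤ)) N
      · simp only [F, if_pos hl, hcoef N l hl]
        have p := qPochR_self_pos hq0 hq1
        have hle := qPochInfR_self_le hq0 hq1
        rw [Real.norm_of_nonneg (mul_nonneg (div_nonneg (p _).le (mul_pos (p _) (p _)).le)
          (by positivity)), inv_eq_one_div]
        refine mul_le_mul_of_nonneg_right ?_ (by positivity)
        exact div_le_div₀ zero_le_one (qPochR_self_le_one hq0 hq1 _) (by positivity)
          (mul_le_mul (hle _) (hle _) hQ.le (p _).le)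
      · simp only [F, if_neg hl, norm_zero]
        positivity
  simp only [hF] at hT
  have h := tendsto_nhds_unique hT ((tendsto_prod_qPochInfR hq0 hq1 (-t * q)).mul
    (tendsto_prod_qPochInfR hq0 hq1 (-1 / t)))
  rw [tsum_mul_left] at h
  rw [← h]
  field_simp

/-- The moments of the discrete Stieltjes-Wigert measure. -/
lemma hasSum_moment {q : ℝ} (hq0 : 0 < q) (hq1 : q < 1) {t : ℝ} (ht : 0 < t) (j : ℕ) :
    HasSum (fun k : ℤ => t ^ k * q ^ (k * (k + 1) / 2) * (t * q ^ k) ^ j)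
      (q ^ (-((j + 1).choose 2 : ℤ)) *
        (qPochInfR q (-t * q) * qPochInfR q (-1 / t) * qPochInfR q q)) := by
  have h := (summable_theta hq0 hq1 ht).hasSum
  rw [tsum_theta hq0 hq1 ht, ← (Equiv.addRight (j : ℤ)).hasSum_iff] at h
  refine (congrArg (HasSum · _) (funext fun k => ?_)).mpr
    (h.mul_left (q ^ (-((j + 1).choose 2 : ℤ))))
  have e : q ^ (k * (k + 1) / 2) * (q ^ k) ^ j =
      q ^ (-((j + 1).choose 2 : ℤ)) * q ^ ((k + j) * (k + j + 1) / 2) := by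
    rw [← zpow_natCast, ← zpow_mul, ← zpow_add₀ hq0.ne', ← zpow_add₀ hq0.ne']
    congr 1
    have h₁ := triangle_two_mul k
    have h₂ := triangle_two_mul (k + j)
    have h₃ := choose_two_two_mul (j + 1)
    push_cast at *
    linarith
  simp only [Function.comp, Equiv.coe_addRight]
  rw [zpow_add₀ ht.ne', zpow_natCast, mul_pow]
  linear_combination t ^ k * t ^ j * e

lemma stieltjesWigertR_eq {q : ℝ} (hq0 : 0 < q) (hq1 : q < 1) (n : ℕ) (x : ℝ) :
    stieltjesWigertR q n x = ∑ k ∈ range (n + 1),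
      ((-1) ^ k * q ^ (k ^ 2) / (qPochR q q k * qPochR q q (n - k))) * x ^ k := by
  have p := fun n => (qPochR_self_pos hq0 hq1 n).ne'
  rw [stieltjesWigertR, Finset.mul_sum]
  refine Finset.sum_congr rfl fun k _ => ?_
  have := p n
  have := p k
  have := p (n - k)
  field_simp

/-- The pairing of `x^j` with `S_n`, up to the total mass. -/
lemma sum_coeff_mul_moment {q : ℝ} (hq0 : 0 < q) (hq1 : q < 1) (n j : ℕ) :
    ∑ k ∈ range (n + 1), ((-1) ^ k * q ^ (k ^ 2) / (qPochR q q k * qPochR q q (n - k))) *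
        q ^ (-((k + j + 1).choose 2 : ℤ)) =
      q ^ (-((j + 1).choose 2 : ℤ)) / qPochR q q n *
        ∏ i ∈ range n, (1 - q ^ (-(j : ℤ)) * q ^ i) := by
  have hz := sum_qBinomR_mul_pow q (-q ^ (-(j : ℤ))) n
  simp only [neg_mul, ← sub_eq_add_neg] at hz
  rw [← hz, Finset.mul_sum]
  refine Finset.sum_congr rfl fun k hk => ?_
  obtain ⟨m, rfl⟩ := Nat.exists_eq_add_of_le (Nat.lt_succ_iff.1 (Finset.mem_range.1 hk))
  rw [Nat.add_sub_cancel_left, qBinomR_add hq0 hq1, neg_pow (q ^ (-(j : ℤ))), ← zpow_natCast (q ^ (-(j : ℤ))),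
    ← zpow_mul]
  have e : q ^ (k ^ 2) * q ^ (-((k + j + 1).choose 2 : ℤ)) =
      q ^ (-((j + 1).choose 2 : ℤ)) * (q ^ (k.choose 2) * q ^ (-(j : ℤ) * k)) := by
    rw [← zpow_natCast, ← zpow_natCast, ← zpow_add₀ hq0.ne', ← zpow_add₀ hq0.ne',
      ← zpow_add₀ hq0.ne']
    congr 1
    have h₁ := choose_two_two_mul k
    have h₂ := choose_two_two_mul (k + j + 1)
    have h₃ := choose_two_two_mul (j + 1)
    push_cast at *
    linarith
  have h₁ := (qPochR_self_pos hq0 hq1 k).ne'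
  have h₂ := (qPochR_self_pos hq0 hq1 m).ne'
  have h₃ := (qPochR_self_pos hq0 hq1 (k + m)).ne'
  calc _ = (-1) ^ k / (qPochR q q k * qPochR q q m) *
        (q ^ (k ^ 2) * q ^ (-((k + j + 1).choose 2 : ℤ))) := by ring
    _ = _ := by
      rw [e]
      field_simp

lemma prod_one_sub_zpow_eq_zero {q : ℝ} (hq0 : 0 < q) {n j : ℕ} (h : j < n) :
    ∏ i ∈ range n, (1 - q ^ (-(j : ℤ)) * q ^ i) = 0 := by
  refine Finset.prod_eq_zero (Finset.mem_range.2 h) ?_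
  rw [← zpow_natCast, ← zpow_add₀ hq0.ne', neg_add_cancel, zpow_zero, sub_self]

lemma prod_one_sub_zpow_self {q : ℝ} (hq0 : 0 < q) (n : ℕ) :
    ∏ i ∈ range n, (1 - q ^ (-(n : ℤ)) * q ^ i) =
      (-1) ^ n * q ^ (-((n + 1).choose 2 : ℤ)) * qPochR q q n := by
  rw [← Finset.prod_range_reflect]
  have h : ∏ i ∈ range n, (1 - q ^ (-(n : ℤ)) * q ^ (n - 1 - i)) =
      ∏ i ∈ range n, (1 - (q ^ (i + 1))⁻¹) := by
    refine Finset.prod_congr rfl fun i hi => ?_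
    have hi' := Finset.mem_range.1 hi
    rw [← zpow_natCast, ← zpow_natCast, ← zpow_neg, ← zpow_add₀ hq0.ne']
    congr 2
    omega
  rw [h]
  clear h
  induction n with
  | zero => simp [qPochR_zero]
  | succ n ih =>
    rw [Finset.prod_range_succ, ih, qPochR_self_succ, Nat.choose_succ_succ' (n + 1) 1,
      Nat.choose_one_right, Nat.cast_add, neg_add, zpow_add₀ hq0.ne', zpow_neg q ((n + 1 : ℕ) : ℤ),
      zpow_natCast]
    have : q ^ (n + 1) ≠ 0 := by positivity
    field_simp
    ring

lemma hasSum_stieltjesWigertR_mul {q : ℝ} (hq0 : 0 < q) (hq1 : q < 1) {t : ℝ} (ht : 0 < t)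
    {n m : ℕ} (hmn : m ≤ n) :
    HasSum (fun k : ℤ => t ^ k * q ^ (k * (k + 1) / 2) *
        stieltjesWigertR q n (t * q ^ k) * stieltjesWigertR q m (t * q ^ k))
      ((if m = n then 1 else 0) *
        qPochInfR q (-t * q) * qPochInfR q (-1 / t) * qPochInfR q q /
          (q ^ n * qPochR q q n)) := by
  set θ := qPochInfR q (-t * q) * qPochInfR q (-1 / t) * qPochInfR q q with hθ
  let a : ℕ → ℕ → ℝ := fun n k => (-1) ^ k * q ^ (k ^ 2) / (qPochR q q k * qPochR q q (n - k))
  have hsum : HasSum (fun k : ℤ => ∑ j ∈ range (m + 1), ∑ i ∈ range (n + 1), a m j * (a n i *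
      (t ^ k * q ^ (k * (k + 1) / 2) * (t * q ^ k) ^ (i + j))))
      (∑ j ∈ range (m + 1), ∑ i ∈ range (n + 1), a m j * (a n i *
        (q ^ (-((i + j + 1).choose 2 : ℤ)) * θ))) :=
    hasSum_sum fun j _ => hasSum_sum fun i _ =>
      ((hasSum_moment hq0 hq1 ht (i + j)).mul_left _).mul_left _
  convert hsum using 1
  · funext k
    rw [stieltjesWigertR_eq hq0 hq1, stieltjesWigertR_eq hq0 hq1, mul_assoc, mul_comm (∑ _ ∈ _, _),
      Finset.sum_mul_sum, Finset.mul_sum]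
    refine Finset.sum_congr rfl fun j _ => ?_
    rw [Finset.mul_sum]
    refine Finset.sum_congr rfl fun i _ => ?_
    simp only [a, pow_add]
    ring
  · have hD : ∀ j, ∑ i ∈ range (n + 1), a m j * (a n i *
        (q ^ (-((i + j + 1).choose 2 : ℤ)) * θ)) =
        a m j * (q ^ (-((j + 1).choose 2 : ℤ)) / qPochR q q n *
          ∏ i ∈ range n, (1 - q ^ (-(j : ℤ)) * q ^ i)) * θ := by
      intro j
      rw [← sum_coeff_mul_moment hq0 hq1, Finset.mul_sum, Finset.sum_mul]
      exact Finset.sum_congr rfl fun i _ => by simp only [a]; ring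
    rw [Finset.sum_congr rfl fun j _ => hD j, Finset.sum_range_succ, Finset.sum_eq_zero, zero_add]
    · rcases hmn.lt_or_eq with h | rfl
      · rw [prod_one_sub_zpow_eq_zero hq0 h, if_neg h.ne]
        simp
      · have hP := (qPochR_self_pos hq0 hq1 m).ne'
        have e : q ^ (m ^ 2) * (q ^ (-((m + 1).choose 2 : ℤ)) * q ^ (-((m + 1).choose 2 : ℤ))) =
            (q ^ m)⁻¹ := by
          rw [← zpow_natCast, ← zpow_natCast, ← zpow_add₀ hq0.ne', ← zpow_add₀ hq0.ne', ← zpow_neg]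
          congr 1
          have h₁ := choose_two_two_mul (m + 1)
          push_cast at *
          linarith
        have hs : ((-1 : ℝ) ^ m) * (-1) ^ m = 1 := by rw [← mul_pow]; simp
        rw [prod_one_sub_zpow_self hq0]
        simp only [a, Nat.sub_self, qPochR_zero, if_true]
        calc _ = (q ^ m)⁻¹ / qPochR q q m * θ := by
              rw [hθ]
              field_simp
          _ = ((-1 : ℝ) ^ m * (-1) ^ m) * (q ^ (m ^ 2) * (q ^ (-((m + 1).choose 2 : ℤ)) *
              q ^ (-((m + 1).choose 2 : ℤ)))) / qPochR q q m * θ := by rw [e, hs, one_mul]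
          _ = _ := by
              field_simp
    · intro j hj
      rw [prod_one_sub_zpow_eq_zero hq0 ((Finset.mem_range.1 hj).trans_le hmn)]
      simp

/-- for `0 < q < 1` and `t > 0`, the Stieltjes--Wigert polynomials are
orthogonal with respect to the discrete measure `Σ_{k∈ℤ} t^k q^{k(k+1)/2} δ_{t q^k}`:
the doubly infinite sum converges absolutely and
`Σ_{k∈ℤ} t^k q^{k(k+1)/2} S_n(t q^k;q) S_m(t q^k;q)
  = δ_{m,n} (-tq;q)_∞ (-1/t;q)_∞ (q;q)_∞/(q^n (q;q)_n)`. -/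
theorem stieltjesWigert_discrete_orthogonality (q : ℝ) (hq0 : 0 < q) (hq1 : q < 1)
    (t : ℝ) (ht : 0 < t) (n m : ℕ) :
    (Summable fun k : ℤ =>
      |t ^ k * q ^ (k * (k + 1) / 2) *
        stieltjesWigertR q n (t * q ^ k) * stieltjesWigertR q m (t * q ^ k)|) ∧
    ∑' k : ℤ, t ^ k * q ^ (k * (k + 1) / 2) *
        stieltjesWigertR q n (t * q ^ k) * stieltjesWigertR q m (t * q ^ k) =
      (if m = n then 1 else 0) *
        qPochInfR q (-t * q) * qPochInfR q (-1 / t) * qPochInfR q q /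
          (q ^ n * qPochR q q n) := by
  have h : HasSum (fun k : ℤ => t ^ k * q ^ (k * (k + 1) / 2) *
        stieltjesWigertR q n (t * q ^ k) * stieltjesWigertR q m (t * q ^ k))
      ((if m = n then 1 else 0) *
        qPochInfR q (-t * q) * qPochInfR q (-1 / t) * qPochInfR q q /
          (q ^ n * qPochR q q n)) := by
    rcases le_or_gt m n with hmn | hnm
    · exact hasSum_stieltjesWigertR_mul hq0 hq1 ht hmn
    · have h := hasSum_stieltjesWigertR_mul hq0 hq1 ht hnm.le
      rw [if_neg hnm.ne] at h
      rw [if_neg hnm.ne']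
      simpa only [zero_mul, zero_div, mul_right_comm] using h
  exact ⟨h.summable.abs, h.tsum_eq⟩
end
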